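/- Let S = {(0,1),(0,4),(1,3),(2,3),(2,4),(3,1),(3,3),(3,5),(4,0),(4,2),(4,4),(4,5),(5,2),(5,5)} ⊆ ℕ×ℕ. The generalised toric code C_S over the field with 8 elements has minimum distance exactly 26: every nonzero codeword of C_S has Hamming weight at least 26, and some codeword of C_S has Hamming weight exactly 26. -/

import Mathlib

/-- `F8` is the finite field with 8 elements, `GF(2,3)`. -/
abbrev F8 : Type := GaloisField 2 3

/-- The evaluation vector of an exponent pair `(a, b)`: the function
`F8ˣ × F8ˣ → F8` sending `(x, y)` to `x ^ a * y ^ b`. -/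
noncomputable def evalVec (ab : ℕ × ℕ) : F8ˣ × F8ˣ → F8 :=
  fun xy => (xy.1 : F8) ^ ab.1 * (xy.2 : F8) ^ ab.2

/-- The Hamming weight of a vector `c : F8ˣ × F8ˣ → F8`: the number of
coordinates at which `c` is nonzero. -/
noncomputable def hammingWeight (c : F8ˣ × F8ˣ → F8) : ℕ :=
  Nat.card {p : F8ˣ × F8ˣ // c p ≠ 0}

/-- The set of exponent vectors. -/
def S : Set (ℕ × ℕ) := {(0,1),(0,4),(1,3),(2,3),(2,4),(3,1),(3,3),(3,5),(4,0),(4,2),(4,4),(4,5),(5,2),(5,5)}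

namespace TC

/-- `2 ^ 192`, the size of a lane. -/
def LW : ℕ := 0x1000000000000000000000000000000000000000000000000

/-- Packing of a list of lanes in a single number. -/
def pack : List ℕ → ℕ := List.rec 0 (fun v _ acc => Nat.add v (Nat.mul LW acc))

def ones42 : ℕ := pack (List.replicate 42 1)

def elimB (B M low : ℕ) : ℕ :=
  (fun C => Nat.add (Nat.mod C low) (Nat.mul (Nat.div C (Nat.mul low LW)) low))
    (Nat.xor B (Nat.mul M (Nat.mod (Nat.div B low) LW)))

def elimA (B M : ℕ) : ℕ := elimB B M (Nat.xor M (Nat.land M (Nat.sub M 1)))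

/-- Impose the vanishing of bit `p`. -/
def elim1 (B p : ℕ) : ℕ := elimA B (Nat.land (Nat.shiftRight B p) ones42)

def elim3 (B p : ℕ) : ℕ := elim1 (elim1 (elim1 B p) (Nat.add p 64)) (Nat.add p 128)

/-- one popcount step -/
def pstep (ones m k X : ℕ) : ℕ :=
  (fun mm => Nat.add (Nat.land X mm) (Nat.land (Nat.shiftRight X k) mm)) (Nat.mul ones m)

def pm1 : ℕ := 0x5555555555555555
def pm2 : ℕ := 0x3333333333333333
def pm3 : ℕ := 0x0f0f0f0f0f0f0f0f
def pm4 : ℕ := 0x00ff00ff00ff00ff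
def pm5 : ℕ := 0x0000ffff0000ffff
def pm6 : ℕ := 0x00000000ffffffff
def m49 : ℕ := 0x1ffffffffffff

def or3 (ones X : ℕ) : ℕ :=
  Nat.land (Nat.lor X (Nat.lor (Nat.shiftRight X 64) (Nat.shiftRight X 128))) (Nat.mul ones m49)

def popc (ones X : ℕ) : ℕ :=
  pstep ones pm6 32 (pstep ones pm5 16 (pstep ones pm4 8 (pstep ones pm3 4
    (pstep ones pm2 2 (pstep ones pm1 1 (or3 ones X))))))

def final (ones X : ℕ) : Bool :=
  Nat.beq (Nat.land (Nat.add (popc ones X) (Nat.mul ones 38)) (Nat.mul ones 64))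
    (Nat.mul (Nat.sub ones 1) 64)

def leaf (fuel : ℕ) : ℕ → ℕ → ℕ → ℕ → Bool :=
  Nat.rec (fun _ _ _ _ => false)
    (fun _ ih B ones X sh =>
      Bool.rec
        (ih (Nat.div B LW) (Nat.add ones (Nat.shiftLeft ones sh))
          (Nat.add X (Nat.shiftLeft (Nat.xor X (Nat.mul ones (Nat.mod B LW))) sh))
          (Nat.add sh sh))
        (final ones X)
        (Nat.beq B 0)) fuel

def leaf0 (B : ℕ) : Bool := leaf 43 B 1 0 192

def sub (cont : ℕ → Bool) (ps : List ℕ) : ℕ → ℕ → Bool :=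
  List.rec (fun k B => Bool.rec true (cont B) (Nat.beq k 0))
    (fun p ps ih k B =>
      Bool.rec
        (Bool.rec
          (and (ih (Nat.sub k 1) (elim3 B p)) (ih k B))
          true
          (Nat.ble (Nat.add 2 (List.length ps)) k))
        (cont B) (Nat.beq k 0)) ps

def row (j : ℕ) : List ℕ := [7*j, 7*j+1, 7*j+2, 7*j+3, 7*j+4, 7*j+5, 7*j+6]
def first (l : List ℕ) (B : ℕ) : ℕ := List.rec B (fun p _ acc => elim3 acc p) l

def genL : List ℕ := [
  0x1d3a74e9d3a740000e9d3a74e9d3a0001a74e9d3a74e9,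
  0xe9d3a74e9d3a000074e9d3a74e9d0001d3a74e9d3a74,
  0x74e9d3a74e9d00013a74e9d3a74e0000e9d3a74e9d3a,
  0xe9d3a74e9d3a00013a74e9d3a74e0001a74e9d3a74e9,
  0x13a74e9d3a74e00014e9d3a74e9d30000e9d3a74e9d3a,
  0x14e9d3a74e9d30001d3a74e9d3a7400013a74e9d3a74e,
  0x5f2b95d2f95c000170be572ba5f2000195cae97cae17,
  0x170be572ba5f20001cae17cae574b00005f2b95d2f95c,
  0x1cae17cae574b00012f95c2f95cae000170be572ba5f2,
  0x1957722ee65dc00005dccbb9957720000e65dccabb917,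
  0x5dccbb9957720001732aee45dccb0001957722ee65dc,
  0x1732aee45dccb0001c8bb997732ae00005dccbb995772,
  0x9fa4ed2769ba0001a4ed3749fa4e0000769ba4fd2769,
  0x1a4ed3749fa4e0000e93f49da4ed300009fa4ed2769ba,
  0xe93f49da4ed300013b49da6e93f40001a4ed3749fa4e,
  0x9dd533ba677400014cee99dd13ba00013ba27754cee9,
  0x14cee99dd13ba0001a67744eea99d00009dd533ba6774,
  0x1a67744eea99d0001d13baa6774ce00014cee99dd13ba,
  0xe7965965d75c0001965975d71cf20000bae39e596597,
  0x1965975d71cf200005d75c73cb2cb0000e7965965d75c,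
  0x5d75c73cb2cb000171cf2cb2cbae0001965975d71cf2,
  0x12d739ca5ee720000e7297b9ca5ae00017394b5ce7297,
  0xe7297b9ca5ae00005ee7296b9ce500012d739ca5ee72,
  0x5ee7296b9ce50001ca5ae7394bdc0000e7297b9ca5ae,
  0x3ffffe03f800001fc000fffff800001fff80fe0007f,
  0x1fc000fffff800001fc07f0003fff000003ffffe03f80,
  0x1fc07f0003fff0001fffff01fc0000001fc000fffff80,
  0xeb4a73bd29ce00014e73ad29cef400009cef4a739d69,
  0x14e73ad29cef4000077a539ceb4a70000eb4a73bd29ce,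
  0x77a539ceb4a70001a539de94e73a00014e73ad29cef4,
  0x1d34d34f38eba000075d74d34d3ce00014d3ce3aeba69,
  0x75d74d34d3ce00009e71d75d34d30001d34d34f38eba,
  0x9e71d75d34d30001a69a79c75d74000075d74d34d3ce,
  0x170be572ba5f200012f95c2f95cae000195cae97cae17,
  0x12f95c2f95cae0000e574be570be5000170be572ba5f2,
  0xe574be570be500005f2b95d2f95c00012f95c2f95cae,
  0x9e9e9e8e8ece0000e8ece4f4f4f40001d1d1d9c9e9e9,
  0xe8ece4f4f4f400014f4f4747672700009e9e9e8e8ece,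
  0x14f4f47476727000076727a7a7a3a0000e8ece4f4f4f4,
  0x1965975d71cf2000171cf2cb2cbae0000bae39e596597,
  0x171cf2cb2cbae00012cbaeb8e79650001965975d71cf2,
  0x12cbaeb8e79650000e7965965d75c000171cf2cb2cbae]

theorem LW_eq : LW = 2 ^ 192 := by decide +kernel
theorem LW_pos : 0 < LW := by rw [LW_eq]; positivity

attribute [irreducible] LW

@[simp] theorem pack_nil : pack [] = 0 := rfl
@[simp] theorem pack_cons (v : ℕ) (t : List ℕ) : pack (v :: t) = v + LW * pack t := rfl

theorem lane_mod {a A : ℕ} (ha : a < LW) : (a + LW * A) % LW = a := by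
  rw [Nat.add_mul_mod_self_left, Nat.mod_eq_of_lt ha]

theorem lane_div {a A : ℕ} (ha : a < LW) : (a + LW * A) / LW = A := by
  rw [Nat.add_mul_div_left _ _ LW_pos, Nat.div_eq_of_lt ha, zero_add]

theorem lane_inj {a b A B : ℕ} (ha : a < LW) (hb : b < LW)
    (h : a + LW * A = b + LW * B) : a = b ∧ A = B := by
  constructor
  · rw [← lane_mod (A := A) ha, h, lane_mod hb]
  · rw [← lane_div (A := A) ha, h, lane_div hb]

theorem land_split (X m R : ℕ) (hm : m < LW) :
    X &&& (m + LW * R) = ((X % LW) &&& m) + LW * ((X / LW) &&& R) := by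
  rw [← Nat.mod_add_div (X &&& (m + LW * R)) LW]
  congr 1
  · conv_lhs => rw [LW_eq, Nat.and_mod_two_pow, ← LW_eq, lane_mod hm]
  · congr 1
    conv_lhs => rw [LW_eq, Nat.and_div_two_pow, ← LW_eq, lane_div hm]

theorem xor_split (a A b B : ℕ) (ha : a < LW) (hb : b < LW) :
    (a + LW * A) ^^^ (b + LW * B) = (a ^^^ b) + LW * (A ^^^ B) := by
  rw [← Nat.mod_add_div ((a + LW * A) ^^^ (b + LW * B)) LW]
  congr 1
  · conv_lhs => rw [LW_eq, Nat.xor_mod_two_pow, ← LW_eq, lane_mod hb, lane_mod ha]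
  · congr 1
    conv_lhs => rw [LW_eq, Nat.xor_div_two_pow, ← LW_eq, lane_div hb, lane_div ha]

theorem or_split (a A b B : ℕ) (ha : a < LW) (hb : b < LW) :
    (a + LW * A) ||| (b + LW * B) = (a ||| b) + LW * (A ||| B) := by
  rw [← Nat.mod_add_div ((a + LW * A) ||| (b + LW * B)) LW]
  congr 1
  · conv_lhs => rw [LW_eq, Nat.or_mod_two_pow, ← LW_eq, lane_mod hb, lane_mod ha]
  · congr 1
    conv_lhs => rw [LW_eq, Nat.or_div_two_pow, ← LW_eq, lane_div hb, lane_div ha]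

theorem xor_lt_LW {a b : ℕ} (ha : a < LW) (hb : b < LW) : a ^^^ b < LW := by
  rw [LW_eq] at *; exact Nat.xor_lt_two_pow ha hb

/-- All lanes are in range. -/
def Small (ls : List ℕ) : Prop := ∀ v ∈ ls, v < LW

/-- masking a shifted packed number -/
theorem shift_mask (k m : ℕ) (hm : m < 2 ^ (192 - k)) (ls : List ℕ) (hs : Small ls) :
    ∀ n, ls.length ≤ n → (pack ls >>> k) &&& (pack (List.replicate n 1) * m)
      = pack (ls.map fun v => (v >>> k) &&& m) := by
  have hmL : m < LW := by
    rw [LW_eq]; exact lt_of_lt_of_le hm (Nat.pow_le_pow_right (by norm_num) (by omega))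
  induction ls with
  | nil => intro n _; simp
  | cons v t ih =>
    intro n hn
    obtain ⟨n, rfl⟩ : ∃ n', n = n' + 1 := ⟨n - 1, by simp at hn; omega⟩
    have hv : v < LW := hs v (by simp)
    have ih' := ih (fun w hw => hs w (by simp [hw])) n (by simpa using hn)
    simp only [List.replicate_succ, pack_cons, List.map_cons, add_mul, one_mul, mul_assoc]
    rw [land_split _ _ _ hmL, ← ih']
    congr 1
    · apply Nat.eq_of_testBit_eq
      intro i
      rw [LW_eq]
      simp only [Nat.testBit_and, Nat.testBit_mod_two_pow, Nat.testBit_shiftRight]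
      by_cases hi : i < 192 - k
      · have h1 : i < 192 := by omega
        have h2 : k + i < 192 := by omega
        rw [add_comm v, Nat.testBit_two_pow_mul_add _ (by rw [← LW_eq]; exact hv)]
        simp [h1, h2]
      · have : m.testBit i = false := Nat.testBit_lt_two_pow
          (lt_of_lt_of_le hm (Nat.pow_le_pow_right (by norm_num) (by omega)))
        simp [this]
    · congr 2
      rw [Nat.shiftRight_eq_div_pow, Nat.div_div_eq_div_mul, mul_comm (2 ^ k), ← Nat.div_div_eq_div_mul,
        lane_div hv, Nat.shiftRight_eq_div_pow]

theorem mask_only (m : ℕ) (hm : m < LW) (ls : List ℕ) (hs : Small ls) (n : ℕ)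
    (hn : ls.length ≤ n) : (pack ls) &&& (pack (List.replicate n 1) * m)
      = pack (ls.map fun v => v &&& m) := by
  have := shift_mask 0 m (by rw [LW_eq] at hm; exact hm) ls hs n hn
  simpa using this

theorem xor_scaled (f : ℕ → ℕ) (v : ℕ) (hv : v < LW) (ls : List ℕ) (hs : Small ls)
    (hf : ∀ u ∈ ls, f u = 0 ∨ f u = 1) :
    pack ls ^^^ (pack (ls.map f) * v) = pack (ls.map fun u => if f u = 1 then u ^^^ v else u) := by
  induction ls with
  | nil => simp
  | cons u t ih =>
    have ih' := ih (fun w hw => hs w (by simp [hw])) (fun w hw => hf w (by simp [hw]))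
    have hu : u < LW := hs u (by simp)
    simp only [List.map_cons, pack_cons, add_mul, mul_assoc]
    rcases hf u (by simp) with h | h
    · rw [h, zero_mul, xor_split _ _ _ _ hu LW_pos, ih']; simp
    · rw [h, one_mul, xor_split _ _ _ _ hu hv, ih']; simp

theorem elimA_zero (T M v : ℕ) (hv : v < LW) :
    elimA (v + LW * T) (LW * M) = v + LW * elimA T M := by
  have hlow : Nat.xor (LW * M) (Nat.land (LW * M) (Nat.sub (LW * M) 1))
      = LW * (Nat.xor M (Nat.land M (Nat.sub M 1))) := by
    change (LW * M) ^^^ ((LW * M) &&& (LW * M - 1)) = LW * (M ^^^ (M &&& (M - 1)))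
    rcases Nat.eq_zero_or_pos M with rfl | hM
    · simp
    · have h1 : LW * M - 1 = (LW - 1) + LW * (M - 1) := by
        obtain ⟨M, rfl⟩ : ∃ m, M = m + 1 := ⟨M - 1, by omega⟩
        have := LW_pos
        simp only [Nat.add_sub_cancel, mul_add, mul_one]; omega
      rw [h1, land_split _ _ _ (by have := LW_pos; omega), Nat.mul_mod_right,
        Nat.mul_div_cancel_left _ LW_pos, Nat.zero_and, zero_add]
      have := xor_split 0 M 0 (M &&& (M - 1)) LW_pos LW_pos
      simpa using this
  unfold elimA
  rw [hlow]
  generalize Nat.xor M (Nat.land M (Nat.sub M 1)) = low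
  unfold elimB
  change ((v + LW * T) ^^^ (LW * M * ((v + LW * T) / (LW * low) % LW))) % (LW * low)
     + ((v + LW * T) ^^^ (LW * M * ((v + LW * T) / (LW * low) % LW))) / (LW * low * LW) * (LW * low)
     = v + LW * ((T ^^^ (M * (T / low % LW))) % low + (T ^^^ (M * (T / low % LW))) / (low * LW) * low)
  rw [← Nat.div_div_eq_div_mul, lane_div hv]
  have h := xor_split v T 0 (M * (T / low % LW)) hv LW_pos
  rw [zero_add, Nat.xor_zero, ← mul_assoc] at h
  rw [h]
  generalize T ^^^ (M * (T / low % LW)) = C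
  rw [Nat.mod_mul, lane_mod hv, lane_div hv, mul_assoc LW low LW, ← Nat.div_div_eq_div_mul, lane_div hv]
  ring

theorem elimA_one (T M v : ℕ) (hv : v < LW) :
    elimA (v + LW * T) (1 + LW * M) = T ^^^ (M * v) := by
  have h1 : (1 : ℕ) < LW := by rw [LW_eq]; norm_num
  have hlow : Nat.xor (1 + LW * M) (Nat.land (1 + LW * M) (Nat.sub (1 + LW * M) 1)) = 1 := by
    change (1 + LW * M) ^^^ ((1 + LW * M) &&& (1 + LW * M - 1)) = 1
    rw [Nat.add_sub_cancel_left]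
    have := land_split (1 + LW * M) 0 M LW_pos
    rw [zero_add] at this
    rw [this, lane_div h1, Nat.and_zero, Nat.and_self, xor_split _ _ _ _ h1 LW_pos]
    simp
  unfold elimA
  rw [hlow]
  unfold elimB
  change ((v + LW * T) ^^^ ((1 + LW * M) * ((v + LW * T) / 1 % LW))) % 1
     + ((v + LW * T) ^^^ ((1 + LW * M) * ((v + LW * T) / 1 % LW))) / (1 * LW) * 1 = T ^^^ (M * v)
  rw [Nat.div_one, lane_mod hv, Nat.mod_one, one_mul, zero_add, mul_one, add_mul, one_mul, mul_assoc,
    xor_split _ _ _ _ hv hv, Nat.xor_self, lane_div LW_pos]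

/-- Elimination on lists. -/
def elimL (p : ℕ) : List ℕ → List ℕ
  | [] => []
  | v :: t => if v.testBit p then t.map (fun u => if u.testBit p then u ^^^ v else u)
      else v :: elimL p t

theorem shr_and_one (v p : ℕ) : (v >>> p) &&& 1 = if v.testBit p then 1 else 0 := by
  rw [Nat.testBit, Nat.and_comm]
  have : 1 &&& (v >>> p) = 0 ∨ 1 &&& (v >>> p) = 1 := by
    rw [Nat.one_and_eq_mod_two]; omega
  rcases this with h | h <;> simp [h]

theorem elimA_zero_zero : elimA 0 0 = 0 := by decide +kernel

theorem elim1_pack (p : ℕ) (hp : p < 192) (ls : List ℕ) (hs : Small ls) (hl : ls.length ≤ 42) :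
    elim1 (pack ls) p = pack (elimL p ls) := by
  have hM : Nat.land (Nat.shiftRight (pack ls) p) ones42
      = pack (ls.map fun v => (v >>> p) &&& 1) := by
    have := shift_mask p 1 (Nat.one_lt_two_pow (by omega)) ls hs 42 hl
    rw [mul_one] at this
    exact this
  unfold elim1
  rw [hM]
  clear hM hl
  induction ls with
  | nil =>
    exact elimA_zero_zero
  | cons v t ih =>
    have hst : Small t := fun w hw => hs w (by simp [hw])
    have hv : v < LW := hs v (by simp)
    simp only [List.map_cons, pack_cons, elimL]
    by_cases hb : v.testBit p
    · simp only [hb, shr_and_one v p, if_true]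
      rw [elimA_one _ _ _ hv, xor_scaled _ _ hv _ hst]
      · congr 1
        apply List.map_congr_left
        intro u _
        rw [shr_and_one]
        by_cases h : u.testBit p <;> simp [h]
      · intro u _
        rw [shr_and_one]
        by_cases h : u.testBit p <;> simp [h]
    · rw [shr_and_one v p, if_neg hb, zero_add, elimA_zero _ _ _ hv, ih hst, if_neg hb]
      rfl

/-- `n` is a sum (xor) of a sublist of the list. -/
def Sp : List ℕ → ℕ → Prop
  | [], n => n = 0
  | v :: t, n => Sp t n ∨ Sp t (n ^^^ v)

theorem Sp_map (p v : ℕ) (t : List ℕ) : ∀ m, Sp t m →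
    Sp (t.map (fun u => if u.testBit p then u ^^^ v else u)) (if m.testBit p then m ^^^ v else m) := by
  induction t with
  | nil => intro m hm; simp only [Sp] at hm; subst hm; simp [Sp]
  | cons u t ih =>
    intro m hm
    simp only [List.map_cons, Sp] at hm ⊢
    rcases hm with h | h
    · exact Or.inl (ih m h)
    · right
      have := ih _ h
      convert this using 1
      rw [Nat.testBit_xor]
      cases hm : m.testBit p <;> cases hu : u.testBit p <;> simp [Nat.xor_comm, Nat.xor_left_comm]

theorem Sp_elimL (p : ℕ) (ls : List ℕ) : ∀ n, Sp ls n → n.testBit p = false →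
    Sp (elimL p ls) n := by
  induction ls with
  | nil => intro n h _; exact h
  | cons v t ih =>
    intro n h hn
    simp only [elimL]
    by_cases hv : v.testBit p
    · rw [if_pos hv]
      rcases h with h | h
      · have := Sp_map p v t _ h
        simpa [hn] using this
      · have := Sp_map p v t _ h
        simpa [hn, hv, Nat.xor_assoc] using this
    · rw [if_neg hv]
      rcases h with h | h
      · exact Or.inl (ih _ h hn)
      · exact Or.inr (ih _ h (by simp [hn, hv]))

/-- `n` lies in the space described by the packed basis `B`. -/
def Good (B n : ℕ) : Prop := ∃ ls : List ℕ, B = pack ls ∧ ls.length ≤ 42 ∧ Small ls ∧ Sp ls n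

theorem elimL_length (p : ℕ) (ls : List ℕ) : (elimL p ls).length ≤ ls.length := by
  induction ls with
  | nil => simp [elimL]
  | cons v t ih =>
    simp only [elimL]
    split_ifs
    · simp
    · simpa using ih

theorem elimL_small (p : ℕ) (ls : List ℕ) (hs : Small ls) : Small (elimL p ls) := by
  induction ls with
  | nil => simpa [elimL] using hs
  | cons v t ih =>
    have hst : Small t := fun w hw => hs w (by simp [hw])
    have hv : v < LW := hs v (by simp)
    simp only [elimL]
    split_ifs
    · intro w hw
      rw [List.mem_map] at hw
      obtain ⟨u, hu, rfl⟩ := hw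
      split_ifs
      · exact xor_lt_LW (hst u hu) hv
      · exact hst u hu
    · intro w hw
      rcases List.mem_cons.1 hw with rfl | hw
      · exact hv
      · exact ih hst w hw

theorem elim1_good {B n p : ℕ} (hp : p < 192) (h : Good B n) (hn : n.testBit p = false) :
    Good (elim1 B p) n := by
  obtain ⟨ls, rfl, hl, hs, hS⟩ := h
  exact ⟨elimL p ls, elim1_pack p hp ls hs hl, (elimL_length p ls).trans hl,
    elimL_small p ls hs, Sp_elimL p ls n hS hn⟩

/-- The symbol of the word `n` at position `p` vanishes. -/
def zeroAt (n p : ℕ) : Bool := !(n.testBit p || n.testBit (p + 64) || n.testBit (p + 128))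

theorem elim3_good {B n p : ℕ} (hp : p < 64) (h : Good B n) (hn : zeroAt n p = true) :
    Good (elim3 B p) n := by
  simp only [zeroAt, Bool.not_eq_true', Bool.or_eq_false_iff] at hn
  exact elim1_good (by change p + 128 < 192; omega)
    (elim1_good (by change p + 64 < 192; omega) (elim1_good (by omega) h hn.1.1) hn.1.2) hn.2

theorem sub_good (cont : ℕ → Bool) (n : ℕ) (ps : List ℕ) (hps : ∀ p ∈ ps, p < 64) :
    ∀ k B, sub cont ps k B = true → Good B n → k ≤ ps.countP (zeroAt n) →
      ∃ B', cont B' = true ∧ Good B' n := by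
  induction ps with
  | nil =>
    intro k B h hg hk
    simp only [List.countP_nil, Nat.le_zero_eq] at hk
    subst hk
    exact ⟨B, h, hg⟩
  | cons p ps ih =>
    have ih' := ih (fun q hq => hps q (by simp [hq]))
    intro k B h hg hk
    rcases Nat.eq_zero_or_pos k with rfl | hk0
    · exact ⟨B, h, hg⟩
    · have hkb : Nat.beq k 0 = false := by
        cases k with
        | zero => omega
        | succ k => rfl
      have hle := List.countP_le_length (p := zeroAt n) (l := ps)
      have hc : (p :: ps).countP (zeroAt n) = ps.countP (zeroAt n) + if zeroAt n p then 1 else 0 := by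
        rw [List.countP_cons]
      have hlb : Nat.ble (Nat.add 2 (List.length ps)) k = false := by
        rw [Bool.eq_false_iff]
        intro hh
        have := Nat.le_of_ble_eq_true hh
        change 2 + ps.length ≤ k at this
        split_ifs at hc <;> omega
      have h2 : (sub cont ps (k - 1) (elim3 B p) && sub cont ps k B) = true := by
        have : sub cont (p :: ps) k B = Bool.rec (Bool.rec
          (and (sub cont ps (Nat.sub k 1) (elim3 B p)) (sub cont ps k B))
          true
          (Nat.ble (Nat.add 2 (List.length ps)) k))
          (cont B) (Nat.beq k 0) := rfl
        rw [this, hkb, hlb] at h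
        exact h
      rw [Bool.and_eq_true] at h2
      by_cases hz : zeroAt n p = true
      · refine ih' _ _ h2.1 (elim3_good (hps p (by simp)) hg hz) ?_
        rw [hc, if_pos hz] at hk
        omega
      · rw [hc, if_neg hz] at hk
        exact ih' _ _ h2.2 hg hk

theorem first_good (n : ℕ) (l : List ℕ) (hl : ∀ p ∈ l, p < 64) (hz : ∀ p ∈ l, zeroAt n p = true)
    (B : ℕ) (hg : Good B n) : Good (first l B) n := by
  induction l with
  | nil => exact hg
  | cons p l ih =>
    exact elim3_good (hl p (by simp)) (ih (fun q hq => hl q (by simp [hq]))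
      (fun q hq => hz q (by simp [hq]))) (hz p (by simp))

theorem small_map {ls : List ℕ} {f : ℕ → ℕ} (hf : ∀ v ∈ ls, f v < LW) : Small (ls.map f) := by
  intro w hw
  obtain ⟨u, hu, rfl⟩ := List.mem_map.1 hw
  exact hf u hu

theorem pack_map_add (f g : ℕ → ℕ) (ls : List ℕ) :
    pack (ls.map f) + pack (ls.map g) = pack (ls.map fun v => f v + g v) := by
  induction ls with
  | nil => simp
  | cons v t ih => simp only [List.map_cons, pack_cons, ← ih]; ring

theorem pack_map_or (f g : ℕ → ℕ) (ls : List ℕ) (hf : ∀ v, f v < LW) (hg : ∀ v, g v < LW) :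
    pack (ls.map f) ||| pack (ls.map g) = pack (ls.map fun v => f v ||| g v) := by
  induction ls with
  | nil => simp
  | cons v t ih =>
    simp only [List.map_cons, pack_cons, ← ih]
    exact or_split _ _ _ _ (hf v) (hg v)

theorem pack_rep_mul (m : ℕ) (ls : List ℕ) :
    pack (List.replicate ls.length 1) * m = pack (ls.map fun _ => m) := by
  induction ls with
  | nil => simp
  | cons v t ih =>
    simp only [List.length_cons, List.replicate_succ, List.map_cons, pack_cons, ← ih]; ring

theorem pow64_lt : 2 ^ 64 < LW := by rw [LW_eq]; norm_num

theorem pstep_one (m k x : ℕ) : pstep 1 m k x = (x &&& m) + ((x >>> k) &&& m) := by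
  change (x &&& (1 * m)) + ((x >>> k) &&& (1 * m)) = _
  rw [one_mul]

theorem pstep_one_lt (m k x : ℕ) (hm : m < 2 ^ 63) : pstep 1 m k x < 2 ^ 64 := by
  rw [pstep_one]
  have h1 : x &&& m ≤ m := Nat.and_le_right
  have h2 : (x >>> k) &&& m ≤ m := Nat.and_le_right
  omega

theorem pstep_pack (m k : ℕ) (hm : m < 2 ^ 64) (hk : k ≤ 128) (ls : List ℕ) (hs : Small ls) :
    pstep (pack (List.replicate ls.length 1)) m k (pack ls) = pack (ls.map (pstep 1 m k)) := by
  change (pack ls &&& (pack (List.replicate ls.length 1) * m)) +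
    ((pack ls >>> k) &&& (pack (List.replicate ls.length 1) * m)) = _
  rw [mask_only m (hm.trans pow64_lt) ls hs _ le_rfl,
    shift_mask k m (lt_of_lt_of_le hm (Nat.pow_le_pow_right (by norm_num) (by omega))) ls hs _ le_rfl,
    pack_map_add]
  congr 1
  apply List.map_congr_left
  intro v _
  rw [pstep_one]

theorem or3_one (x : ℕ) : or3 1 x = (x ||| (x >>> 64 ||| x >>> 128)) &&& m49 := by
  change (x ||| (x >>> 64 ||| x >>> 128)) &&& (1 * m49) = _
  rw [one_mul]

theorem m49_lt : m49 < 2 ^ 63 := by decide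

theorem or3_one_lt (x : ℕ) : or3 1 x < 2 ^ 64 := by
  rw [or3_one]
  have h2 : (x ||| (x >>> 64 ||| x >>> 128)) &&& m49 ≤ m49 := Nat.and_le_right
  have := m49_lt
  omega

theorem or3_pack (ls : List ℕ) (hs : Small ls) :
    or3 (pack (List.replicate ls.length 1)) (pack ls) = pack (ls.map (or3 1)) := by
  change (pack ls ||| (pack ls >>> 64 ||| pack ls >>> 128)) &&&
    (pack (List.replicate ls.length 1) * m49) = _
  have hL : m49 < LW := by have := m49_lt; have := pow64_lt; omega
  have hand : ∀ v, v &&& m49 < LW := fun v => lt_of_le_of_lt Nat.and_le_right hL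
  have e1 : m49 < 2 ^ (192 - 64) := by decide
  have e2 : m49 < 2 ^ (192 - 128) := by decide
  rw [Nat.and_or_distrib_right, Nat.and_or_distrib_right, mask_only m49 hL ls hs _ le_rfl,
    shift_mask 64 m49 e1 ls hs _ le_rfl, shift_mask 128 m49 e2 ls hs _ le_rfl,
    pack_map_or _ _ _ (fun v => hand _) (fun v => hand _), pack_map_or _ _ _ (fun v => hand _)]
  · congr 1
    apply List.map_congr_left
    intro v _
    rw [or3_one, Nat.and_or_distrib_right, Nat.and_or_distrib_right]
  · intro v
    rw [← Nat.and_or_distrib_right]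
    exact hand _

theorem popc_pack (ls : List ℕ) (hs : Small ls) :
    popc (pack (List.replicate ls.length 1)) (pack ls) = pack (ls.map (popc 1)) := by
  have step : ∀ (m k : ℕ) (_ : m < 2 ^ 63) (_ : k ≤ 128) (g : ℕ → ℕ) (_ : ∀ v, g v < 2 ^ 64),
      pstep (pack (List.replicate ls.length 1)) m k (pack (ls.map g))
        = pack (ls.map fun v => pstep 1 m k (g v)) := by
    intro m k hm hk g hg
    have := pstep_pack m k (by omega) hk (ls.map g) (small_map fun v _ => (hg v).trans pow64_lt)
    rw [List.length_map, List.map_map] at this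
    exact this
  unfold popc
  rw [or3_pack ls hs, step pm1 1 (by decide) (by decide) _ or3_one_lt,
    step pm2 2 (by decide) (by decide) _ (fun v => pstep_one_lt _ _ _ (by decide)),
    step pm3 4 (by decide) (by decide) _ (fun v => pstep_one_lt _ _ _ (by decide)),
    step pm4 8 (by decide) (by decide) _ (fun v => pstep_one_lt _ _ _ (by decide)),
    step pm5 16 (by decide) (by decide) _ (fun v => pstep_one_lt _ _ _ (by decide)),
    step pm6 32 (by decide) (by decide) _ (fun v => pstep_one_lt _ _ _ (by decide))]

theorem popc_lt (x : ℕ) : popc 1 x < 2 ^ 64 := by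
  unfold popc
  exact pstep_one_lt _ _ _ (by decide)

/-- Sum of the first `N` digits in base `2 ^ k`. -/
def dsum (k : ℕ) : ℕ → ℕ → ℕ
  | 0, _ => 0
  | N + 1, X => X % 2 ^ k + dsum k N (X / 2 ^ k)

def mask (k : ℕ) : ℕ → ℕ
  | 0 => 0
  | N + 1 => (2 ^ k - 1) + 2 ^ (2 * k) * mask k N

theorem and_low (k X R : ℕ) : X &&& ((2 ^ k - 1) + 2 ^ (2 * k) * R)
    = X % 2 ^ k + 2 ^ (2 * k) * ((X / 2 ^ (2 * k)) &&& R) := by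
  have hp : 0 < 2 ^ k := by positivity
  have hlt : 2 ^ k - 1 < 2 ^ (2 * k) := by
    have : 2 ^ k ≤ 2 ^ (2 * k) := Nat.pow_le_pow_right (by norm_num) (by omega)
    omega
  rw [← Nat.mod_add_div (X &&& ((2 ^ k - 1) + 2 ^ (2 * k) * R)) (2 ^ (2 * k))]
  congr 1
  · rw [Nat.and_mod_two_pow, Nat.add_mul_mod_self_left, Nat.mod_eq_of_lt hlt,
      Nat.and_two_pow_sub_one_eq_mod, Nat.mod_mod_of_dvd]
    exact pow_dvd_pow _ (by omega)
  · rw [Nat.and_div_two_pow, Nat.add_mul_div_left _ _ (by positivity), Nat.div_eq_of_lt hlt, zero_add]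

theorem dsum_step (k : ℕ) (hk : 1 ≤ k) (N : ℕ) : ∀ X,
    dsum (2 * k) N (pstep 1 (mask k N) k X) = dsum k (2 * N) X := by
  induction N with
  | zero => intro X; rfl
  | succ N ih =>
    intro X
    have e : pstep 1 (mask k (N + 1)) k X = (X % 2 ^ k + X / 2 ^ k % 2 ^ k)
        + 2 ^ (2 * k) * pstep 1 (mask k N) k (X / 2 ^ (2 * k)) := by
      rw [pstep_one, pstep_one, mask, and_low, and_low, Nat.shiftRight_eq_div_pow,
        Nat.shiftRight_eq_div_pow, Nat.div_div_eq_div_mul, Nat.div_div_eq_div_mul,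
        mul_comm (2 ^ k) (2 ^ (2 * k))]
      ring
    have hlt : X % 2 ^ k + X / 2 ^ k % 2 ^ k < 2 ^ (2 * k) := by
      have h1 := Nat.mod_lt X (show 0 < 2 ^ k by positivity)
      have h2 := Nat.mod_lt (X / 2 ^ k) (show 0 < 2 ^ k by positivity)
      have h3 : 2 * 2 ^ k ≤ 2 ^ (2 * k) := by
        rw [← pow_succ']; exact Nat.pow_le_pow_right (by norm_num) (by omega)
      omega
    rw [dsum, e, Nat.add_mul_mod_self_left, Nat.mod_eq_of_lt hlt,
      Nat.add_mul_div_left _ _ (by positivity), Nat.div_eq_of_lt hlt, zero_add, ih,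
      show 2 * (N + 1) = 2 * N + 1 + 1 by ring, dsum, dsum, Nat.div_div_eq_div_mul, ← pow_add,
      ← two_mul, add_assoc]

theorem popc_eq (x : ℕ) : popc 1 x = dsum 1 64 (or3 1 x) := by
  have h1 : pm1 = mask 1 32 := by decide +kernel
  have h2 : pm2 = mask 2 16 := by decide +kernel
  have h3 : pm3 = mask 4 8 := by decide +kernel
  have h4 : pm4 = mask 8 4 := by decide +kernel
  have h5 : pm5 = mask 16 2 := by decide +kernel
  have h6 : pm6 = mask 32 1 := by decide +kernel
  have hd : ∀ y, y < 2 ^ 64 → y = dsum 64 1 y := by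
    intro y hy
    simp only [dsum, Nat.mod_eq_of_lt hy, add_zero]
  rw [hd _ (popc_lt x)]
  unfold popc
  rw [h1, h2, h3, h4, h5, h6]
  rw [dsum_step 32 (by norm_num) 1, dsum_step 16 (by norm_num) 2, dsum_step 8 (by norm_num) 4,
    dsum_step 4 (by norm_num) 8, dsum_step 2 (by norm_num) 16, dsum_step 1 (by norm_num) 32]

/-- The weight of a word. -/
def wt (n : ℕ) : ℕ := (List.range 49).countP (fun p => !zeroAt n p)

theorem dsum_one (N : ℕ) : ∀ X, dsum 1 N X = (List.range N).countP (fun i => X.testBit i) := by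
  induction N with
  | zero => intro X; rfl
  | succ N ih =>
    intro X
    rw [dsum, ih, List.range_succ_eq_map, List.countP_cons, List.countP_map, add_comm]
    congr 1
    · congr 1
      funext i
      simp only [Function.comp, pow_one, Nat.succ_eq_add_one, Nat.testBit_succ]
    · rw [pow_one, Nat.testBit_zero]
      rcases Nat.mod_two_eq_zero_or_one X with h | h <;> simp [h]

theorem popc_wt (x : ℕ) : popc 1 x = wt x := by
  rw [popc_eq, dsum_one, wt]
  have h64 : List.range 64 = List.range 49 ++ (List.range 15).map (49 + ·) := by decide
  have hm : ∀ i, m49.testBit i = decide (i < 49) := by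
    intro i
    rw [show m49 = 2 ^ 49 - 1 from rfl, Nat.testBit_two_pow_sub_one]
  rw [h64, List.countP_append]
  have hz : ((List.range 15).map (49 + ·)).countP (fun i => (or3 1 x).testBit i) = 0 := by
    rw [List.countP_eq_zero]
    intro a ha
    obtain ⟨b, _, rfl⟩ := List.mem_map.1 ha
    rw [or3_one, Nat.testBit_and, hm]
    simp
  rw [hz, add_zero]
  apply List.countP_congr
  intro i hi
  have hi' : i < 49 := List.mem_range.1 hi
  rw [or3_one, Nat.testBit_and, hm]
  simp [zeroAt, hi', Nat.testBit_shiftRight, add_comm, or_assoc]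

theorem pack_inj : ∀ (l₁ l₂ : List ℕ), l₁.length = l₂.length → Small l₁ → Small l₂ →
    pack l₁ = pack l₂ → l₁ = l₂ := by
  intro l₁
  induction l₁ with
  | nil => intro l₂ h _ _ _; exact (List.length_eq_zero_iff.1 h.symm).symm
  | cons a l₁ ih =>
    intro l₂ h h1 h2 he
    cases l₂ with
    | nil => simp at h
    | cons b l₂ =>
      obtain ⟨e1, e2⟩ := lane_inj (h1 a (by simp)) (h2 b (by simp)) he
      rw [e1, ih l₂ (by simpa using h) (fun w hw => h1 w (by simp [hw]))
        (fun w hw => h2 w (by simp [hw])) e2]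

theorem final_good (ws : List ℕ) (hs : Small (0 :: ws))
    (h : final (pack (List.replicate (ws.length + 1) 1)) (pack (0 :: ws)) = true) :
    ∀ w ∈ ws, 26 ≤ wt w := by
  have h' := Nat.eq_of_beq_eq_true h
  change ((popc (pack (List.replicate (0 :: ws).length 1)) (pack (0 :: ws)) +
    pack (List.replicate (0 :: ws).length 1) * 38) &&& (pack (List.replicate (0 :: ws).length 1) * 64))
    = (1 + LW * pack (List.replicate ws.length 1) - 1) * 64 at h'
  have hlt : ∀ v, popc 1 v + 38 < LW := by
    intro v
    have := popc_lt v
    have : 2 ^ 64 + 38 < LW := by rw [LW_eq]; norm_num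
    omega
  rw [popc_pack _ hs, pack_rep_mul 38, pack_map_add] at h'
  have hm := mask_only 64 (by rw [LW_eq]; norm_num) ((0 :: ws).map fun v => popc 1 v + 38)
    (small_map fun v _ => hlt v) (0 :: ws).length (by simp)
  rw [hm, List.map_map, Nat.add_sub_cancel_left, mul_assoc, pack_rep_mul 64] at h'
  simp only [List.map_cons, pack_cons] at h'
  have h64 : (64 : ℕ) < LW := by rw [LW_eq]; norm_num
  have hb : ∀ v : ℕ, v &&& 64 < LW := fun v => lt_of_le_of_lt Nat.and_le_right h64
  rw [← zero_add (LW * pack (ws.map fun _ => 64))] at h'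
  obtain ⟨_, e⟩ := lane_inj (hb _) LW_pos h'
  have e' := pack_inj _ _ (by simp) (small_map fun v _ => hb _) (small_map fun v _ => h64) e
  intro w hw
  have : (popc 1 w + 38) &&& 64 = 64 := (List.map_inj_left.1 e') w hw
  have h2 : (popc 1 w + 38) &&& 64 ≤ popc 1 w + 38 := Nat.and_le_left
  rw [← popc_wt]
  omega

theorem pack_zero_Sp (ls : List ℕ) : pack ls = 0 → ∀ m, Sp ls m → m = 0 := by
  induction ls with
  | nil => intro _ m h; exact h
  | cons v t ih =>
    intro h m hm
    simp only [pack_cons, Nat.add_eq_zero_iff, Nat.mul_eq_zero] at h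
    have ht : pack t = 0 := h.2.resolve_left (by have := LW_pos; omega)
    rcases hm with hm | hm
    · exact ih ht m hm
    · have := ih ht _ hm
      rw [h.1] at this
      simpa using this

theorem pack_append (a b : List ℕ) : pack (a ++ b) = pack a + (pack b <<< (192 * a.length)) := by
  induction a with
  | nil => simp
  | cons v t ih =>
    rw [List.cons_append, pack_cons, pack_cons, ih, List.length_cons, Nat.shiftLeft_eq,
      Nat.shiftLeft_eq, mul_add 192, pow_add, mul_one, ← LW_eq]
    ring

theorem leaf_good (fuel : ℕ) : ∀ (ls ws : List ℕ), Small ls → Small (0 :: ws) →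
    leaf fuel (pack ls) (pack (List.replicate (ws.length + 1) 1)) (pack (0 :: ws))
      (192 * (ws.length + 1)) = true →
    ∀ n, (∃ w ∈ 0 :: ws, Sp ls (n ^^^ w)) → n = 0 ∨ 26 ≤ wt n := by
  induction fuel with
  | zero => intro ls ws _ _ h; exact absurd h (by simp [leaf])
  | succ fuel ih =>
    intro ls ws hls hws h n hn
    have hunf : leaf (fuel + 1) (pack ls) (pack (List.replicate (ws.length + 1) 1)) (pack (0 :: ws))
      (192 * (ws.length + 1)) = Bool.rec
        (leaf fuel (pack ls / LW) (pack (List.replicate (ws.length + 1) 1) +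
            (pack (List.replicate (ws.length + 1) 1) <<< (192 * (ws.length + 1))))
          (pack (0 :: ws) + ((pack (0 :: ws) ^^^
            (pack (List.replicate (ws.length + 1) 1) * (pack ls % LW))) <<< (192 * (ws.length + 1))))
          (192 * (ws.length + 1) + 192 * (ws.length + 1)))
        (final (pack (List.replicate (ws.length + 1) 1)) (pack (0 :: ws)))
        (Nat.beq (pack ls) 0) := rfl
    rw [hunf] at h
    cases hb : Nat.beq (pack ls) 0 with
    | true =>
      rw [hb] at h
      obtain ⟨w, hw, hS⟩ := hn
      have := pack_zero_Sp ls (Nat.eq_of_beq_eq_true hb) _ hS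
      have hnw : n = w := Nat.xor_eq_zero_iff.1 this
      subst hnw
      rcases List.mem_cons.1 hw with h0 | hw
      · exact Or.inl h0
      · exact Or.inr (final_good ws hws h n hw)
    | false =>
      rw [hb] at h
      cases ls with
      | nil => exact absurd hb (by decide)
      | cons v t =>
        have hv : v < LW := hls v (by simp)
        have ht : Small t := fun w hw => hls w (by simp [hw])
        have hx := xor_scaled (fun _ => 1) v hv (0 :: ws) hws (by simp)
        rw [← pack_rep_mul, List.length_cons, mul_one] at hx
        simp only [if_true] at hx
        have e1 := pack_append (List.replicate (ws.length + 1) 1) (List.replicate (ws.length + 1) 1)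
        have e2 := pack_append (0 :: ws) ((0 :: ws).map fun u => u ^^^ v)
        rw [List.length_replicate] at e1
        rw [List.length_cons] at e2
        simp only [pack_cons v t] at h
        rw [lane_mod hv, lane_div hv, hx, ← e1, ← e2] at h
        have e3 : List.replicate (ws.length + 1) 1 ++ List.replicate (ws.length + 1) 1
            = List.replicate ((ws ++ (0 :: ws).map fun u => u ^^^ v).length + 1) 1 := by
          rw [← List.replicate_add]
          congr 1
          simp
          omega
        have e4 : 192 * (ws.length + 1) + 192 * (ws.length + 1)
            = 192 * ((ws ++ (0 :: ws).map fun u => u ^^^ v).length + 1) := by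
          simp
          omega
        rw [e3, e4, List.cons_append] at h
        refine ih t _ ht ?_ h n ?_
        · rw [← List.cons_append]
          intro w hw
          rcases List.mem_append.1 hw with hw | hw
          · exact hws w hw
          · obtain ⟨u, hu, rfl⟩ := List.mem_map.1 hw
            exact xor_lt_LW (hws u hu) hv
        · obtain ⟨w, hw, hS⟩ := hn
          rw [← List.cons_append]
          rcases hS with hS | hS
          · exact ⟨w, List.mem_append_left _ hw, hS⟩
          · exact ⟨w ^^^ v, List.mem_append_right _ (List.mem_map.2 ⟨w, hw, rfl⟩),
              by rw [← Nat.xor_assoc]; exact hS⟩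

theorem leaf0_good (B n : ℕ) (h : leaf0 B = true) (hg : Good B n) : n = 0 ∨ 26 ≤ wt n := by
  obtain ⟨ls, rfl, _, hs, hS⟩ := hg
  refine leaf_good 43 ls [] hs (fun w hw => ?_) ?_ n ⟨0, by simp, by simpa using hS⟩
  · simp at hw; rw [hw]; exact LW_pos
  · simpa [leaf0] using h

def tst (l : List ℕ) (a ka b kb : ℕ) : Bool :=
  sub (fun B => sub leaf0 (row b) kb B) (row a) ka (first l (pack genL))

theorem genL_small : Small genL := by
  unfold Small; rw [LW_eq]; decide +kernel

theorem genL_good {n : ℕ} (hn : Sp genL n) : Good (pack genL) n :=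
  ⟨genL, rfl, by decide +kernel, genL_small, hn⟩

theorem row_lt {j : ℕ} (hj : j < 7) : ∀ p ∈ row j, p < 64 := by
  intro p hp
  simp only [row, List.mem_cons, List.not_mem_nil, or_false] at hp
  omega

theorem tst_good {n : ℕ} (hn : Sp genL n) {l : List ℕ} {a ka b kb : ℕ} (hl : ∀ p ∈ l, p < 7)
    (ha : a < 7) (hb : b < 7) (h : tst l a ka b kb = true) (hz : ∀ p ∈ l, zeroAt n p = true)
    (h1 : ka ≤ (row a).countP (zeroAt n)) (h2 : kb ≤ (row b).countP (zeroAt n)) :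
    n = 0 ∨ 26 ≤ wt n := by
  have g := first_good n l (fun p hp => by have := hl p hp; omega) hz _ (genL_good hn)
  obtain ⟨B, hB, gB⟩ := sub_good _ n (row a) (row_lt ha) _ _ h g h1
  obtain ⟨C, hC, gC⟩ := sub_good _ n (row b) (row_lt hb) _ _ hB gB h2
  exact leaf0_good C n hC gC

/-- Representatives of the subsets of size `k` of `ℤ/7` under rotation. -/
def reps : ℕ → List (List ℕ)
  | 4 => [[0, 1, 2, 3], [0, 1, 2, 4], [0, 1, 2, 5], [0, 1, 3, 4], [0, 1, 3, 5]]
  | 5 => [[0, 1, 2, 3, 4], [0, 1, 2, 3, 5], [0, 1, 2, 4, 5]]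
  | _ => [[0, 1, 2, 3, 4, 5]]

/-- A distribution of zeros: `k0` zeros in line `0`, `ka` in line `a`, `kb` in line `b`. -/
structure Cfg where
  k0 : ℕ
  a : ℕ
  ka : ℕ
  b : ℕ
  kb : ℕ
deriving DecidableEq

def chk (c : Cfg) : Bool := (reps c.k0).all fun l => tst l c.a c.ka c.b c.kb

def cfgA : List Cfg := [⟨4, 1, 4, 2, 4⟩, ⟨4, 1, 4, 3, 4⟩, ⟨4, 1, 4, 4, 4⟩, ⟨4, 1, 4, 5, 4⟩, ⟨4, 2, 4, 4, 4⟩]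
def cfgB : List Cfg := [⟨5, 1, 4, 2, 3⟩, ⟨5, 1, 4, 3, 3⟩, ⟨5, 2, 4, 1, 3⟩, ⟨5, 2, 4, 3, 3⟩]
def cfgBb : List Cfg := [⟨5, 3, 4, 1, 3⟩, ⟨5, 3, 4, 2, 3⟩, ⟨5, 4, 4, 1, 3⟩, ⟨5, 4, 4, 2, 3⟩]
def cfgBc : List Cfg := [⟨5, 5, 4, 1, 3⟩, ⟨5, 5, 4, 2, 3⟩, ⟨5, 6, 4, 1, 3⟩, ⟨5, 6, 4, 2, 3⟩]
def cfgC : List Cfg := [⟨6, 1, 4, 2, 2⟩, ⟨6, 1, 4, 3, 2⟩, ⟨6, 2, 4, 1, 2⟩, ⟨6, 2, 4, 3, 2⟩,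
  ⟨6, 3, 4, 1, 2⟩, ⟨6, 3, 4, 2, 2⟩, ⟨6, 4, 4, 1, 2⟩, ⟨6, 4, 4, 2, 2⟩,
  ⟨6, 5, 4, 1, 2⟩, ⟨6, 5, 4, 2, 2⟩, ⟨6, 6, 4, 1, 2⟩, ⟨6, 6, 4, 2, 2⟩]
def cfgD : List Cfg := [⟨6, 1, 3, 2, 3⟩, ⟨6, 1, 3, 3, 3⟩, ⟨6, 2, 3, 3, 3⟩,
  ⟨6, 1, 6, 1, 0⟩, ⟨6, 2, 6, 1, 0⟩, ⟨6, 3, 6, 1, 0⟩, ⟨6, 4, 6, 1, 0⟩, ⟨6, 5, 6, 1, 0⟩, ⟨6, 6, 6, 1, 0⟩]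

def cfgs : List Cfg := cfgA ++ (cfgB ++ (cfgBb ++ (cfgBc ++ (cfgC ++ cfgD))))

set_option maxRecDepth 100000 in
theorem ok_41424 : chk ⟨4, 1, 4, 2, 4⟩ = true := by decide +kernel
set_option maxRecDepth 100000 in
theorem ok_41434 : chk ⟨4, 1, 4, 3, 4⟩ = true := by decide +kernel
set_option maxRecDepth 100000 in
theorem ok_41444 : chk ⟨4, 1, 4, 4, 4⟩ = true := by decide +kernel
set_option maxRecDepth 100000 in
theorem ok_41454 : chk ⟨4, 1, 4, 5, 4⟩ = true := by decide +kernel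
set_option maxRecDepth 100000 in
theorem ok_42444 : chk ⟨4, 2, 4, 4, 4⟩ = true := by decide +kernel

theorem cfgA_ok : cfgA.all chk = true := by
  simp only [cfgA, List.all_cons, List.all_nil, Bool.and_true,
    ok_41424, ok_41434, ok_41444, ok_41454, ok_42444]

set_option maxRecDepth 100000 in
theorem ok_51423 : chk ⟨5, 1, 4, 2, 3⟩ = true := by decide +kernel
set_option maxRecDepth 100000 in
theorem ok_51433 : chk ⟨5, 1, 4, 3, 3⟩ = true := by decide +kernel
set_option maxRecDepth 100000 in
theorem ok_52413 : chk ⟨5, 2, 4, 1, 3⟩ = true := by decide +kernel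
set_option maxRecDepth 100000 in
theorem ok_52433 : chk ⟨5, 2, 4, 3, 3⟩ = true := by decide +kernel

theorem cfgB_ok : cfgB.all chk = true := by
  simp only [cfgB, List.all_cons, List.all_nil, Bool.and_true,
    ok_51423, ok_51433, ok_52413, ok_52433]

set_option maxRecDepth 100000 in
theorem ok_53413 : chk ⟨5, 3, 4, 1, 3⟩ = true := by decide +kernel
set_option maxRecDepth 100000 in
theorem ok_53423 : chk ⟨5, 3, 4, 2, 3⟩ = true := by decide +kernel
set_option maxRecDepth 100000 in
theorem ok_54413 : chk ⟨5, 4, 4, 1, 3⟩ = true := by decide +kernel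
set_option maxRecDepth 100000 in
theorem ok_54423 : chk ⟨5, 4, 4, 2, 3⟩ = true := by decide +kernel

theorem cfgBb_ok : cfgBb.all chk = true := by
  simp only [cfgBb, List.all_cons, List.all_nil, Bool.and_true,
    ok_53413, ok_53423, ok_54413, ok_54423]

set_option maxRecDepth 100000 in
theorem ok_55413 : chk ⟨5, 5, 4, 1, 3⟩ = true := by decide +kernel
set_option maxRecDepth 100000 in
theorem ok_55423 : chk ⟨5, 5, 4, 2, 3⟩ = true := by decide +kernel
set_option maxRecDepth 100000 in
theorem ok_56413 : chk ⟨5, 6, 4, 1, 3⟩ = true := by decide +kernel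
set_option maxRecDepth 100000 in
theorem ok_56423 : chk ⟨5, 6, 4, 2, 3⟩ = true := by decide +kernel

theorem cfgBc_ok : cfgBc.all chk = true := by
  simp only [cfgBc, List.all_cons, List.all_nil, Bool.and_true,
    ok_55413, ok_55423, ok_56413, ok_56423]

set_option maxRecDepth 100000 in
theorem ok_61422 : chk ⟨6, 1, 4, 2, 2⟩ = true := by decide +kernel
set_option maxRecDepth 100000 in
theorem ok_61432 : chk ⟨6, 1, 4, 3, 2⟩ = true := by decide +kernel
set_option maxRecDepth 100000 in
theorem ok_62412 : chk ⟨6, 2, 4, 1, 2⟩ = true := by decide +kernel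
set_option maxRecDepth 100000 in
theorem ok_62432 : chk ⟨6, 2, 4, 3, 2⟩ = true := by decide +kernel
set_option maxRecDepth 100000 in
theorem ok_63412 : chk ⟨6, 3, 4, 1, 2⟩ = true := by decide +kernel
set_option maxRecDepth 100000 in
theorem ok_63422 : chk ⟨6, 3, 4, 2, 2⟩ = true := by decide +kernel
set_option maxRecDepth 100000 in
theorem ok_64412 : chk ⟨6, 4, 4, 1, 2⟩ = true := by decide +kernel
set_option maxRecDepth 100000 in
theorem ok_64422 : chk ⟨6, 4, 4, 2, 2⟩ = true := by decide +kernel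
set_option maxRecDepth 100000 in
theorem ok_65412 : chk ⟨6, 5, 4, 1, 2⟩ = true := by decide +kernel
set_option maxRecDepth 100000 in
theorem ok_65422 : chk ⟨6, 5, 4, 2, 2⟩ = true := by decide +kernel
set_option maxRecDepth 100000 in
theorem ok_66412 : chk ⟨6, 6, 4, 1, 2⟩ = true := by decide +kernel
set_option maxRecDepth 100000 in
theorem ok_66422 : chk ⟨6, 6, 4, 2, 2⟩ = true := by decide +kernel

theorem cfgC_ok : cfgC.all chk = true := by
  simp only [cfgC, List.all_cons, List.all_nil, Bool.and_true,
    ok_61422, ok_61432, ok_62412, ok_62432, ok_63412, ok_63422, ok_64412, ok_64422, ok_65412, ok_65422, ok_66412, ok_66422]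

set_option maxRecDepth 100000 in
theorem ok_61323 : chk ⟨6, 1, 3, 2, 3⟩ = true := by decide +kernel
set_option maxRecDepth 100000 in
theorem ok_61333 : chk ⟨6, 1, 3, 3, 3⟩ = true := by decide +kernel
set_option maxRecDepth 100000 in
theorem ok_62333 : chk ⟨6, 2, 3, 3, 3⟩ = true := by decide +kernel
set_option maxRecDepth 100000 in
theorem ok_61610 : chk ⟨6, 1, 6, 1, 0⟩ = true := by decide +kernel
set_option maxRecDepth 100000 in
theorem ok_62610 : chk ⟨6, 2, 6, 1, 0⟩ = true := by decide +kernel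
set_option maxRecDepth 100000 in
theorem ok_63610 : chk ⟨6, 3, 6, 1, 0⟩ = true := by decide +kernel
set_option maxRecDepth 100000 in
theorem ok_64610 : chk ⟨6, 4, 6, 1, 0⟩ = true := by decide +kernel
set_option maxRecDepth 100000 in
theorem ok_65610 : chk ⟨6, 5, 6, 1, 0⟩ = true := by decide +kernel
set_option maxRecDepth 100000 in
theorem ok_66610 : chk ⟨6, 6, 6, 1, 0⟩ = true := by decide +kernel

theorem cfgD_ok : cfgD.all chk = true := by
  simp only [cfgD, List.all_cons, List.all_nil, Bool.and_true,
    ok_61323, ok_61333, ok_62333, ok_61610, ok_62610, ok_63610, ok_64610, ok_65610, ok_66610]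

theorem cfgs_ok : ∀ c ∈ cfgs, chk c = true := by
  intro c hc
  simp only [cfgs, List.mem_append] at hc
  rcases hc with h | h | h | h | h | h
  · exact List.all_eq_true.1 cfgA_ok c h
  · exact List.all_eq_true.1 cfgB_ok c h
  · exact List.all_eq_true.1 cfgBb_ok c h
  · exact List.all_eq_true.1 cfgBc_ok c h
  · exact List.all_eq_true.1 cfgC_ok c h
  · exact List.all_eq_true.1 cfgD_ok c h

theorem cfgs_lt : ∀ c ∈ cfgs, c.a < 7 ∧ c.b < 7 := by decide

theorem reps_lt (k : ℕ) : ∀ l ∈ reps k, ∀ p ∈ l, p < 7 := by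
  unfold reps
  split <;> decide

theorem cfg_good {n : ℕ} (hn : Sp genL n) {c : Cfg} (hc : c ∈ cfgs) {l : List ℕ}
    (hl : l ∈ reps c.k0) (hz : ∀ p ∈ l, zeroAt n p = true)
    (h1 : c.ka ≤ (row c.a).countP (zeroAt n)) (h2 : c.kb ≤ (row c.b).countP (zeroAt n)) :
    n = 0 ∨ 26 ≤ wt n :=
  tst_good hn (reps_lt _ l hl) (cfgs_lt c hc).1 (cfgs_lt c hc).2
    (List.all_eq_true.1 (cfgs_ok c hc) l hl) hz h1 h2

/-- Number of true values. -/
def cnt (f : Fin 7 → Bool) : ℕ := ∑ i, if f i then 1 else 0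

theorem pat4 : ∀ f : Fin 7 → Bool, 4 ≤ cnt f → ∃ r : Fin 7, ∃ l ∈ reps 4, ∀ p ∈ l, f (r + Fin.ofNat 7 p) = true := by
  decide +kernel
theorem pat5 : ∀ f : Fin 7 → Bool, 5 ≤ cnt f → ∃ r : Fin 7, ∃ l ∈ reps 5, ∀ p ∈ l, f (r + Fin.ofNat 7 p) = true := by
  decide +kernel
theorem pat6 : ∀ f : Fin 7 → Bool, 6 ≤ cnt f → ∃ r : Fin 7, ∃ l ∈ reps 6, ∀ p ∈ l, f (r + Fin.ofNat 7 p) = true := by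
  decide +kernel

theorem cfgs_k0 : ∀ c ∈ cfgs, c.k0 = 4 ∨ c.k0 = 5 ∨ c.k0 = 6 := by decide

theorem pat {c : Cfg} (hc : c ∈ cfgs) (f : Fin 7 → Bool) (hf : c.k0 ≤ cnt f) :
    ∃ r : Fin 7, ∃ l ∈ reps c.k0, ∀ p ∈ l, f (r + Fin.ofNat 7 p) = true := by
  rcases cfgs_k0 c hc with h | h | h <;> rw [h] at hf ⊢
  · exact pat4 f hf
  · exact pat5 f hf
  · exact pat6 f hf

/-- The configuration `c` occurs at line `t`. -/
def Occ (k : Fin 7 → ℕ) (t : Fin 7) (c : Cfg) : Prop :=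
  c.k0 ≤ k t ∧ c.ka ≤ k (t + Fin.ofNat 7 c.a) ∧ c.kb ≤ k (t + Fin.ofNat 7 c.b)

theorem three_large : ∀ f : Fin 7 → Bool, 3 ≤ cnt f → ∃ t : Fin 7, ∃ c ∈ cfgA,
    f t = true ∧ f (t + Fin.ofNat 7 c.a) = true ∧ f (t + Fin.ofNat 7 c.b) = true := by
  decide +kernel

theorem cfgA_four : ∀ c ∈ cfgA, c.k0 = 4 ∧ c.ka = 4 ∧ c.kb = 4 := by decide

theorem ofNat_val (a : Fin 7) : Fin.ofNat 7 (a : ℕ) = a := by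
  revert a; decide

theorem occ_big (x : Fin 7 → ℕ) (a t t' u v w : Fin 7)
    (hm : (⟨6, a, 6, 1, 0⟩ : Cfg) ∈ cfgs ∧ (⟨6, a, 4, t, 2⟩ : Cfg) ∈ cfgs ∧
      (⟨6, a, 4, t', 2⟩ : Cfg) ∈ cfgs ∧ (⟨5, a, 4, t, 3⟩ : Cfg) ∈ cfgs ∧
      (⟨5, a, 4, t', 3⟩ : Cfg) ∈ cfgs)
    (h7 : x 0 ≤ 7) (hs : 24 ≤ x 0 + x a + x t + x t' + x u + x v + x w) (hmax : x a ≤ x 0)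
    (ha : 4 ≤ x a) (hr : x t ≤ 3 ∧ x t' ≤ 3 ∧ x u ≤ 3 ∧ x v ≤ 3 ∧ x w ≤ 3) :
    ∃ c ∈ cfgs, c.k0 ≤ x 0 ∧ c.ka ≤ x (Fin.ofNat 7 c.a) ∧ c.kb ≤ x (Fin.ofNat 7 c.b) := by
  have h : (6 ≤ x 0 ∧ 6 ≤ x a) ∨ (6 ≤ x 0 ∧ 2 ≤ x t) ∨ (6 ≤ x 0 ∧ 2 ≤ x t') ∨
      (5 ≤ x 0 ∧ 3 ≤ x t) ∨ (5 ≤ x 0 ∧ 3 ≤ x t') := by omega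
  obtain ⟨c1, c2, c3, c4, c5⟩ := hm
  rcases h with h | h | h | h | h
  · refine ⟨_, c1, h.1, ?_, Nat.zero_le _⟩
    simpa only [ofNat_val] using h.2
  · refine ⟨_, c2, h.1, ?_⟩
    simp only [ofNat_val]; exact ⟨ha, h.2⟩
  · refine ⟨_, c3, h.1, ?_⟩
    simp only [ofNat_val]; exact ⟨ha, h.2⟩
  · refine ⟨_, c4, h.1, ?_⟩
    simp only [ofNat_val]; exact ⟨ha, h.2⟩
  · refine ⟨_, c5, h.1, ?_⟩
    simp only [ofNat_val]; exact ⟨ha, h.2⟩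

theorem pair_le (x : Fin 7 → ℕ) (hc : cnt (fun j => decide (4 ≤ x j)) < 3) (h0 : 4 ≤ x 0)
    (a : Fin 7) (ha0 : a ≠ 0) (ha : 4 ≤ x a) (b : Fin 7) (hb0 : b ≠ 0) (hb : b ≠ a) : x b ≤ 3 := by
  by_contra hlt
  have key : ∀ f : Fin 7 → Bool, cnt f < 3 → f 0 = true → ∀ a, a ≠ 0 → f a = true →
      ∀ b, b ≠ 0 → b ≠ a → f b = false := by decide +kernel
  have := key _ hc (by simpa using h0) a ha0 (by simpa using ha) b hb0 hb
  simp only [decide_eq_false_iff_not] at this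
  omega

theorem occ_max (x : Fin 7 → ℕ) (h7 : ∀ j, x j ≤ 7) (hs : 24 ≤ ∑ j, x j)
    (hmax : ∀ j, x j ≤ x 0) (hc : cnt (fun j => decide (4 ≤ x j)) < 3) :
    ∃ c ∈ cfgs, c.k0 ≤ x 0 ∧ c.ka ≤ x (Fin.ofNat 7 c.a) ∧ c.kb ≤ x (Fin.ofNat 7 c.b) := by
  rw [Fin.sum_univ_seven] at hs
  have h0 : 4 ≤ x 0 := by
    have := hmax 1; have := hmax 2; have := hmax 3; have := hmax 4; have := hmax 5; have := hmax 6
    omega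
  have big : ∀ a t t' u v w : Fin 7, 4 ≤ x a →
      ((⟨6, a, 6, 1, 0⟩ : Cfg) ∈ cfgs ∧ (⟨6, a, 4, t, 2⟩ : Cfg) ∈ cfgs ∧
      (⟨6, a, 4, t', 2⟩ : Cfg) ∈ cfgs ∧ (⟨5, a, 4, t, 3⟩ : Cfg) ∈ cfgs ∧
      (⟨5, a, 4, t', 3⟩ : Cfg) ∈ cfgs) →
      (a ≠ 0 ∧ t ≠ 0 ∧ t ≠ a ∧ t' ≠ 0 ∧ t' ≠ a ∧ u ≠ 0 ∧ u ≠ a ∧ v ≠ 0 ∧ v ≠ a ∧ w ≠ 0 ∧ w ≠ a) →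
      24 ≤ x 0 + x a + x t + x t' + x u + x v + x w →
      ∃ c ∈ cfgs, c.k0 ≤ x 0 ∧ c.ka ≤ x (Fin.ofNat 7 c.a) ∧ c.kb ≤ x (Fin.ofNat 7 c.b) := by
    intro a t t' u v w ha hm hn hsum
    obtain ⟨n0, n1, n2, n3, n4, n5, n6, n7, n8, n9, n10⟩ := hn
    have P := pair_le x hc h0 a n0 ha
    exact occ_big x a t t' u v w hm (h7 0) hsum (hmax a) ha
      ⟨P t n1 n2, P t' n3 n4, P u n5 n6, P v n7 n8, P w n9 n10⟩
  by_cases h1 : 4 ≤ x 1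
  · exact big 1 2 3 4 5 6 h1 (by decide) (by decide) (by omega)
  by_cases h2 : 4 ≤ x 2
  · exact big 2 1 3 4 5 6 h2 (by decide) (by decide) (by omega)
  by_cases h3 : 4 ≤ x 3
  · exact big 3 1 2 4 5 6 h3 (by decide) (by decide) (by omega)
  by_cases h4 : 4 ≤ x 4
  · exact big 4 1 2 3 5 6 h4 (by decide) (by decide) (by omega)
  by_cases h5 : 4 ≤ x 5
  · exact big 5 1 2 3 4 6 h5 (by decide) (by decide) (by omega)
  by_cases h6 : 4 ≤ x 6
  · exact big 6 1 2 3 4 5 h6 (by decide) (by decide) (by omega)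
  have m0 := h7 0
  have h : 6 ≤ x 0 ∧ ((3 ≤ x 1 ∧ 3 ≤ x 2) ∨ (3 ≤ x 1 ∧ 3 ≤ x 3) ∨ (3 ≤ x 2 ∧ 3 ≤ x 3)) := by omega
  obtain ⟨h60, h | h | h⟩ := h
  · exact ⟨⟨6, 1, 3, 2, 3⟩, by decide, h60, h⟩
  · exact ⟨⟨6, 1, 3, 3, 3⟩, by decide, h60, h⟩
  · exact ⟨⟨6, 2, 3, 3, 3⟩, by decide, h60, h⟩

theorem occ (k : Fin 7 → ℕ) (h7 : ∀ j, k j ≤ 7) (hs : 24 ≤ ∑ j, k j) :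
    ∃ t : Fin 7, ∃ c ∈ cfgs, Occ k t c := by
  by_cases hc : 3 ≤ cnt (fun j => decide (4 ≤ k j))
  · obtain ⟨t, c, hcA, h⟩ := three_large _ hc
    obtain ⟨e1, e2, e3⟩ := cfgA_four c hcA
    simp only [decide_eq_true_eq] at h
    refine ⟨t, c, List.mem_append_left _ hcA, ?_⟩
    unfold Occ
    rw [e1, e2, e3]
    exact h
  · obtain ⟨t, -, ht⟩ := Finset.exists_max_image Finset.univ k ⟨0, Finset.mem_univ _⟩
    have hsum : ∑ j, k (t + j) = ∑ j, k j := Equiv.sum_comp (Equiv.addLeft t) k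
    have hcn : cnt (fun j => decide (4 ≤ k (t + j))) = cnt (fun j => decide (4 ≤ k j)) :=
      Equiv.sum_comp (Equiv.addLeft t) (fun j => if decide (4 ≤ k j) then 1 else 0)
    obtain ⟨c, hcc, h⟩ := occ_max (fun j => k (t + j)) (fun j => h7 _) (by rw [hsum]; exact hs)
      (fun j => by simpa using ht (t + j) (Finset.mem_univ _)) (by rw [hcn]; omega)
    exact ⟨t, c, hcc, by simpa [Occ] using h⟩

theorem wt_eq (n : ℕ) : wt n = ∑ j : Fin 7, ∑ i : Fin 7, if zeroAt n (7 * j + i) then 0 else 1 := by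
  have h : List.range 49 = row (0 : Fin 7) ++ (row (1 : Fin 7) ++ (row (2 : Fin 7) ++ (row (3 : Fin 7) ++
      (row (4 : Fin 7) ++ (row (5 : Fin 7) ++ row (6 : Fin 7)))))) := by
    decide
  have hr : ∀ j : ℕ, (row j).countP (fun p => !zeroAt n p)
      = ∑ i : Fin 7, if zeroAt n (7 * j + i) then 0 else 1 := by
    intro j
    have : ∀ q, (if (!zeroAt n q) = true then 1 else 0) = if zeroAt n q = true then 0 else 1 := by
      intro q; cases zeroAt n q <;> rfl
    simp only [row, List.countP_cons, List.countP_nil, Fin.sum_univ_seven, this]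
    simp
    ring
  rw [wt, h]
  simp only [List.countP_append, hr]
  rw [Fin.sum_univ_seven (fun j : Fin 7 => ∑ i : Fin 7, if zeroAt n (7 * j + i) then 0 else 1)]
  simp only [add_assoc]

theorem row_count (n : ℕ) (j : Fin 7) :
    (row j).countP (zeroAt n) = cnt (fun i => zeroAt n (7 * j + i)) := by
  simp only [row, cnt, List.countP_cons, List.countP_nil, Fin.sum_univ_seven]
  simp
  ring

theorem Sp_zero (ls : List ℕ) : Sp ls 0 := by
  induction ls with
  | nil => rfl
  | cons v t ih => exact Or.inl ih

theorem Sp_xor (ls : List ℕ) : ∀ m n, Sp ls m → Sp ls n → Sp ls (m ^^^ n) := by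
  induction ls with
  | nil => intro m n hm hn; simp only [Sp] at *; simp [hm, hn]
  | cons v t ih =>
    intro m n hm hn
    rcases hm with hm | hm <;> rcases hn with hn | hn
    · exact Or.inl (ih _ _ hm hn)
    · right; rw [Nat.xor_assoc]; exact ih _ _ hm hn
    · right
      have := ih _ _ hm hn
      rwa [Nat.xor_assoc, Nat.xor_comm v, ← Nat.xor_assoc] at this
    · left
      have := ih _ _ hm hn
      rwa [Nat.xor_assoc, Nat.xor_comm n, ← Nat.xor_assoc v, Nat.xor_self, Nat.zero_xor] at this

theorem Sp_mem (ls : List ℕ) : ∀ v ∈ ls, Sp ls v := by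
  induction ls with
  | nil => intro v hv; simp at hv
  | cons u t ih =>
    intro v hv
    rcases List.mem_cons.1 hv with rfl | hv
    · right; rw [Nat.xor_self]; exact Sp_zero t
    · exact Or.inl (ih v hv)

/-- A root of `X ^ 3 + X + 1` in the field with eight elements. -/
theorem exists_alpha : ∃ a : F8, a ^ 3 = a + 1 := by
  classical
  have h2 : (2 : F8) = 0 := CharTwo.two_eq_zero
  have : Fintype F8 := Fintype.ofFinite F8
  have hc : Fintype.card F8 = 8 := by
    rw [← Nat.card_eq_fintype_card, GaloisField.card 2 3 (by norm_num)]; norm_num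
  obtain ⟨a, ha⟩ : ∃ a : F8, a ∉ ({0, 1} : Finset F8) := by
    by_contra! hcon
    have h1 : (Finset.univ : Finset F8) ⊆ {0, 1} := fun x _ => hcon x
    have h3 := Finset.card_le_card h1
    rw [Finset.card_univ, hc] at h3
    have h4 : ({0, 1} : Finset F8).card ≤ 2 := Finset.card_le_two
    omega
  simp only [Finset.mem_insert, Finset.mem_singleton, not_or] at ha
  have h7 : a ^ 7 = 1 := by
    have := FiniteField.pow_card_sub_one_eq_one a ha.1
    rwa [hc] at this
  have hf : (a - 1) * ((a ^ 3 - (a + 1)) * (a ^ 3 + a ^ 2 + 1)) = 0 := by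
    linear_combination h7 + (-a ^ 5 + 1) * h2
  rcases mul_eq_zero.1 hf with h | h
  · exact absurd (sub_eq_zero.1 h) ha.2
  rcases mul_eq_zero.1 h with h | h
  · exact ⟨a, sub_eq_zero.1 h⟩
  · refine ⟨a⁻¹, ?_⟩
    have h0 := ha.1
    field_simp
    linear_combination -h + h2

noncomputable def al : F8 := exists_alpha.choose
theorem al_cube : al ^ 3 = al + 1 := exists_alpha.choose_spec

theorem two_zero : (2 : F8) = 0 := CharTwo.two_eq_zero

theorem al_seven : al ^ 7 = 1 := by
  linear_combination (al ^ 4 + al ^ 2 + al + 1) * al_cube + (al ^ 2 + al) * two_zero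

theorem al_ne_zero : al ≠ 0 := by
  intro h
  have := al_cube
  rw [h] at this
  simp at this

theorem al_ne_one : al ≠ 1 := by
  intro h
  have := al_cube
  rw [h] at this
  simp [CharTwo.add_self_eq_zero] at this

noncomputable def alu : F8ˣ := Units.mk0 al al_ne_zero

theorem alu_seven : alu ^ 7 = 1 := by
  ext
  simpa [alu] using al_seven

theorem orderOf_alu : orderOf alu = 7 := by
  have : Fact (Nat.Prime 7) := ⟨by norm_num⟩
  refine orderOf_eq_prime alu_seven ?_
  intro h
  exact al_ne_one (by simpa [alu] using congrArg Units.val h)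

theorem card_units : Nat.card F8ˣ = 7 := by
  rw [Nat.card_units, GaloisField.card 2 3 (by norm_num)]; norm_num

/-- The powers of the primitive element. -/
noncomputable def e (j : Fin 7) : F8ˣ := alu ^ (j : ℕ)

theorem e_add (i j : Fin 7) : e (i + j) = e i * e j := by
  unfold e
  rw [← pow_add, Fin.val_add]
  conv_rhs => rw [← Nat.mod_add_div ((i : ℕ) + j) 7, pow_add, pow_mul, alu_seven, one_pow, mul_one]

theorem e_bij : Function.Bijective e := by
  have : Finite F8ˣ := inferInstance
  have : Fintype F8ˣ := Fintype.ofFinite _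
  rw [Fintype.bijective_iff_injective_and_card]
  constructor
  · intro i j h
    have := pow_inj_mod.1 (show alu ^ (i : ℕ) = alu ^ (j : ℕ) from h)
    rw [orderOf_alu, Nat.mod_eq_of_lt i.2, Nat.mod_eq_of_lt j.2] at this
    exact Fin.ext this
  · rw [← Nat.card_eq_fintype_card (α := F8ˣ), card_units]; rfl

noncomputable def eE : Fin 7 ≃ F8ˣ := Equiv.ofBijective e e_bij

/-- A bit as an element of the field. -/
noncomputable def bit (b : Bool) : F8 := if b then 1 else 0

theorem bit_xor (a b : Bool) : bit (a ^^ b) = bit a + bit b := by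
  cases a <;> cases b <;> simp [bit, CharTwo.add_self_eq_zero]

/-- The element with given coordinates. -/
noncomputable def el (x y z : Bool) : F8 := bit x + bit y * al + bit z * al ^ 2

/-- Coordinates of the powers of `al`. -/
def tab : ℕ → Bool × Bool × Bool
  | 0 => (true, false, false)
  | 1 => (false, true, false)
  | 2 => (false, false, true)
  | 3 => (true, true, false)
  | 4 => (false, true, true)
  | 5 => (true, true, true)
  | _ => (true, false, true)

theorem el_tab (k : ℕ) (hk : k < 7) : el (tab k).1 (tab k).2.1 (tab k).2.2 = al ^ k := by
  have h := al_cube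
  have h2 := two_zero
  interval_cases k <;> simp only [tab, el, bit, if_true, Bool.false_eq_true, if_false]
  · ring
  · ring
  · ring
  · linear_combination -h
  · linear_combination -al * h
  · linear_combination (-al ^ 2 - 1) * h
  · linear_combination (-al ^ 3 - al - 1) * h - al * h2

theorem tab_surj : ∀ x y z : Bool, (x || y || z) = true → ∃ k : Fin 7, tab k = (x, y, z) := by
  decide

theorem el_eq_zero (x y z : Bool) : el x y z = 0 ↔ (x || y || z) = false := by
  constructor
  · intro h
    by_contra hn
    obtain ⟨k, hk⟩ := tab_surj x y z (Bool.eq_true_of_not_eq_false hn)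
    have := el_tab k k.2
    rw [hk] at this
    rw [show el x y z = al ^ (k : ℕ) from this] at h
    exact al_ne_zero (eq_zero_of_pow_eq_zero h)
  · intro h
    simp only [Bool.or_eq_false_iff] at h
    simp [h, el, bit]

theorem el_surj (r : F8) : ∃ x y z, r = el x y z := by
  by_cases h : r = 0
  · exact ⟨false, false, false, by simp [h, el, bit]⟩
  · obtain ⟨k, hk⟩ := e_bij.2 (Units.mk0 r h)
    refine ⟨(tab k).1, (tab k).2.1, (tab k).2.2, ?_⟩
    rw [el_tab k k.2]
    have := congrArg Units.val hk
    simpa [e, alu] using this.symm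

/-- The symbol at position `q`. -/
noncomputable def val (n q : ℕ) : F8 :=
  el (n.testBit q) (n.testBit (q + 64)) (n.testBit (q + 128))

theorem val_xor (m n q : ℕ) : val (m ^^^ n) q = val m q + val n q := by
  simp only [val, el, Nat.testBit_xor, bit_xor]; ring

theorem val_zero (q : ℕ) : val 0 q = 0 := by simp [val, el, bit]

theorem val_eq_zero (n q : ℕ) : val n q = 0 ↔ zeroAt n q = true := by
  rw [val, el_eq_zero, zeroAt, Bool.not_eq_true']

/-- `n` encodes `c`. -/
def Rep (n : ℕ) (c : F8ˣ × F8ˣ → F8) : Prop :=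
  ∀ j i : Fin 7, val n (7 * j + i) = c (e j, e i)

theorem Rep_zero : Rep 0 0 := fun j i => by rw [val_zero]; rfl

theorem Rep_add {m n : ℕ} {c d : F8ˣ × F8ˣ → F8} (h : Rep m c) (h' : Rep n d) :
    Rep (m ^^^ n) (c + d) := fun j i => by
  rw [val_xor, h, h', Pi.add_apply]

/-- The exponents in order. -/
def SL : List (ℕ × ℕ) :=
  [(0,1),(0,4),(1,3),(2,3),(2,4),(3,1),(3,3),(3,5),(4,0),(4,2),(4,4),(4,5),(5,2),(5,5)]

theorem mem_SL (p : ℕ × ℕ) : p ∈ S ↔ p ∈ SL := by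
  simp [S, SL]

theorem gen_ok : ∀ s : Fin 14, ∀ k : Fin 3, ∀ j i : Fin 7,
    (fun n q => (Nat.testBit n q, Nat.testBit n (q + 64), Nat.testBit n (q + 128)))
      (genL.getD (3 * s + k) 0) (7 * j + i)
    = tab ((k + (SL.getD s 0).1 * j + (SL.getD s 0).2 * i) % 7) := by
  decide +kernel

theorem gen_Rep (s : Fin 14) (k : Fin 3) :
    Rep (genL.getD (3 * s + k) 0) (al ^ (k : ℕ) • evalVec (SL.getD s 0)) := by
  intro j i
  have h := gen_ok s k j i
  have h1 := el_tab ((k + (SL.getD s 0).1 * j + (SL.getD s 0).2 * i) % 7) (Nat.mod_lt _ (by norm_num))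
  rw [← h] at h1
  refine Eq.trans h1 ?_
  have hp : ∀ m, al ^ (m % 7) = al ^ m := by
    intro m
    conv_rhs => rw [← Nat.mod_add_div m 7, pow_add, pow_mul, al_seven, one_pow, mul_one]
  rw [hp]
  simp only [Pi.smul_apply, evalVec, e, alu, Units.val_pow_eq_pow_val, Units.val_mk0, smul_eq_mul]
  ring

theorem genL_mem (s : Fin 14) (k : Fin 3) : genL.getD (3 * s + k) 0 ∈ genL := by
  revert s k; decide +kernel

theorem genL_idx : ∀ v ∈ genL, ∃ s : Fin 14, ∃ k : Fin 3, v = genL.getD (3 * s + k) 0 := by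
  decide +kernel

theorem bit_case (b : Bool) {n : ℕ} {c : F8ˣ × F8ˣ → F8} (hS : Sp genL n) (h : Rep n c) :
    ∃ m, Sp genL m ∧ Rep m (bit b • c) := by
  cases b with
  | false => exact ⟨0, Sp_zero _, by simpa [bit] using Rep_zero⟩
  | true => exact ⟨n, hS, by simpa [bit] using h⟩

theorem encode (c : F8ˣ × F8ˣ → F8) (hc : c ∈ Submodule.span F8 (evalVec '' S)) :
    ∃ n, Sp genL n ∧ Rep n c := by
  induction hc using Submodule.closure_induction with
  | zero => exact ⟨0, Sp_zero _, Rep_zero⟩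
  | add x y _ _ hx hy =>
    obtain ⟨m, hm, hm'⟩ := hx
    obtain ⟨n, hn, hn'⟩ := hy
    exact ⟨m ^^^ n, Sp_xor _ _ _ hm hn, Rep_add hm' hn'⟩
  | smul_mem r x hx =>
    obtain ⟨p, hp, rfl⟩ := hx
    obtain ⟨s, hs, rfl⟩ := List.mem_iff_getElem.1 ((mem_SL p).1 hp)
    have hs' : s < 14 := hs
    have g : ∀ k : Fin 3, Rep (genL.getD (3 * s + k) 0) (al ^ (k : ℕ) • evalVec SL[s]) := by
      intro k
      have := gen_Rep ⟨s, hs'⟩ k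
      rwa [List.getD_eq_getElem _ _ hs] at this
    have m : ∀ k : Fin 3, Sp genL (genL.getD (3 * s + k) 0) := fun k =>
      Sp_mem _ _ (genL_mem ⟨s, hs'⟩ k)
    obtain ⟨a, b, d, rfl⟩ := el_surj r
    obtain ⟨m0, s0, r0⟩ := bit_case a (m 0) (g 0)
    obtain ⟨m1, s1, r1⟩ := bit_case b (m 1) (g 1)
    obtain ⟨m2, s2, r2⟩ := bit_case d (m 2) (g 2)
    refine ⟨_, Sp_xor _ _ _ (Sp_xor _ _ _ s0 s1) s2, ?_⟩
    have := Rep_add (Rep_add r0 r1) r2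
    have key : ∀ v : F8ˣ × F8ˣ → F8, bit a • al ^ ((0 : Fin 3) : ℕ) • v
        + bit b • al ^ ((1 : Fin 3) : ℕ) • v + bit d • al ^ ((2 : Fin 3) : ℕ) • v = el a b d • v := by
      intro v
      funext q
      simp only [el, Pi.smul_apply, Pi.add_apply, smul_eq_mul, Fin.val_zero, Fin.val_one, Fin.val_two]
      ring
    rw [key] at this
    exact this

theorem decode (ls : List ℕ) (hls : ∀ v ∈ ls, ∃ c ∈ Submodule.span F8 (evalVec '' S), Rep v c) :
    ∃ c ∈ Submodule.span F8 (evalVec '' S), Rep (ls.foldr (· ^^^ ·) 0) c := by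
  induction ls with
  | nil => exact ⟨0, Submodule.zero_mem _, Rep_zero⟩
  | cons v t ih =>
    obtain ⟨c, hc, hr⟩ := hls v (by simp)
    obtain ⟨d, hd, hr'⟩ := ih (fun w hw => hls w (by simp [hw]))
    exact ⟨c + d, Submodule.add_mem _ hc hd, Rep_add hr hr'⟩

theorem weight_sum (c : F8ˣ × F8ˣ → F8) (z : Fin 7 → Fin 7 → Bool)
    (hz : ∀ j i, z j i = true ↔ c (e j, e i) = 0) :
    hammingWeight c = ∑ j, ∑ i, if z j i then 0 else 1 := by
  have E : {p : Fin 7 × Fin 7 // z p.1 p.2 = false} ≃ {p : F8ˣ × F8ˣ // c p ≠ 0} :=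
    Equiv.subtypeEquiv (Equiv.prodCongr eE eE) (by
      rintro ⟨j, i⟩
      change z j i = false ↔ c (e j, e i) ≠ 0
      rw [ne_eq, ← hz, Bool.not_eq_true])
  rw [hammingWeight, ← Nat.card_congr E, Nat.card_eq_fintype_card, Fintype.card_subtype,
    Finset.card_filter, Fintype.sum_prod_type]
  refine Finset.sum_congr rfl fun j _ => Finset.sum_congr rfl fun i _ => ?_
  cases z j i <;> simp

theorem Rep_zeroAt {n : ℕ} {c : F8ˣ × F8ˣ → F8} (h : Rep n c) (j i : Fin 7) :
    zeroAt n (7 * j + i) = true ↔ c (e j, e i) = 0 := by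
  rw [← h, val_eq_zero]

theorem weight_wt {n : ℕ} {c : F8ˣ × F8ˣ → F8} (h : Rep n c) : hammingWeight c = wt n := by
  rw [wt_eq, weight_sum c _ (Rep_zeroAt h)]

/-- Translation of the coordinates. -/
noncomputable def tr (u v : F8ˣ) (c : F8ˣ × F8ˣ → F8) : F8ˣ × F8ˣ → F8 := fun p => c (u * p.1, v * p.2)

theorem tr_mem (u v : F8ˣ) (c : F8ˣ × F8ˣ → F8) (hc : c ∈ Submodule.span F8 (evalVec '' S)) :
    tr u v c ∈ Submodule.span F8 (evalVec '' S) := by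
  induction hc using Submodule.span_induction with
  | mem x hx =>
    obtain ⟨p, hp, rfl⟩ := hx
    have : tr u v (evalVec p) = ((u : F8) ^ p.1 * (v : F8) ^ p.2) • evalVec p := by
      funext q
      simp only [tr, evalVec, Pi.smul_apply, smul_eq_mul, Units.val_mul, mul_pow]
      ring
    rw [this]
    exact Submodule.smul_mem _ _ (Submodule.subset_span ⟨p, hp, rfl⟩)
  | zero => exact Submodule.zero_mem _
  | add x y _ _ hx hy => exact Submodule.add_mem _ hx hy
  | smul a x _ hx => exact Submodule.smul_mem _ a hx

theorem tr_weight (u v : F8ˣ) (c : F8ˣ × F8ˣ → F8) : hammingWeight (tr u v c) = hammingWeight c :=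
  Nat.card_congr (Equiv.subtypeEquiv (Equiv.prodCongr (Equiv.mulLeft u) (Equiv.mulLeft v))
    (fun _ => Iff.rfl))

theorem tr_eq_zero (u v : F8ˣ) (c : F8ˣ × F8ˣ → F8) (h : tr u v c = 0) : c = 0 := by
  funext p
  have := congrFun h (u⁻¹ * p.1, v⁻¹ * p.2)
  simpa [tr] using this

theorem lower (c : F8ˣ × F8ˣ → F8) (hc : c ∈ Submodule.span F8 (evalVec '' S)) (h0 : c ≠ 0) :
    26 ≤ hammingWeight c := by
  classical
  by_contra hlt
  set z : Fin 7 → Fin 7 → Bool := fun j i => decide (c (e j, e i) = 0) with hz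
  have hw := weight_sum c z (fun j i => by simp [hz])
  have hk : ∀ j, cnt (z j) + ∑ i, (if z j i then 0 else 1) = 7 := by
    intro j
    rw [cnt, ← Finset.sum_add_distrib]
    have : ∀ i, ((if z j i = true then 1 else 0) + if z j i = true then 0 else 1) = 1 := by
      intro i; cases z j i <;> rfl
    simp [this]
  have hsum : ∑ j, cnt (z j) + ∑ j, ∑ i, (if z j i then 0 else 1) = 49 := by
    rw [← Finset.sum_add_distrib, Finset.sum_congr rfl fun j _ => hk j]
    rfl
  obtain ⟨t, g, hg, o1, o2, o3⟩ := occ (fun j => cnt (z j)) (fun j => by have := hk j; omega)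
    (by omega)
  obtain ⟨r, l, hl, hp⟩ := pat hg (z t) o1
  obtain ⟨n, hS, hn⟩ := encode _ (tr_mem (e t) (e r) c hc)
  have hzn : ∀ j i : Fin 7, zeroAt n (7 * j + i) = z (t + j) (r + i) := by
    intro j i
    rw [Bool.eq_iff_iff, Rep_zeroAt hn]
    simp [hz, tr, e_add]
  have hcnt : ∀ j : Fin 7, (row j).countP (zeroAt n) = cnt (z (t + j)) := by
    intro j
    rw [row_count]
    simp only [hzn]
    exact Equiv.sum_comp (Equiv.addLeft r) (fun i => if z (t + j) i then 1 else 0)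
  have hval : ∀ a : ℕ, a < 7 → ((Fin.ofNat 7 a : Fin 7) : ℕ) = a := fun a ha => Nat.mod_eq_of_lt ha
  have res := cfg_good hS hg hl (by
      intro p hpl
      have h1 := hzn 0 (Fin.ofNat 7 p)
      rw [hval p (reps_lt _ l hl p hpl), add_zero, hp p hpl] at h1
      simpa using h1)
    (by
      have := hcnt (Fin.ofNat 7 g.a)
      rw [hval _ (cfgs_lt g hg).1] at this
      rw [this]; exact o2)
    (by
      have := hcnt (Fin.ofNat 7 g.b)
      rw [hval _ (cfgs_lt g hg).2] at this
      rw [this]; exact o3)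
  rcases res with h | h
  · subst h
    apply h0
    apply tr_eq_zero (e t) (e r)
    funext p
    obtain ⟨j, hj⟩ := e_bij.2 p.1
    obtain ⟨i, hi⟩ := e_bij.2 p.2
    have := hn j i
    rw [val_zero, hj, hi] at this
    exact this.symm
  · rw [← weight_wt hn, tr_weight] at h
    exact hlt h

def witness : List ℕ := [4, 6, 7, 8, 9, 10, 11, 12, 16, 17, 18, 19, 21, 22, 28, 31, 33, 35, 36, 39].map
  fun i => genL.getD i 0

theorem witness_wt : wt (witness.foldr (· ^^^ ·) 0) = 26 := by decide +kernel
theorem witness_mem : ∀ v ∈ witness, v ∈ genL := by decide +kernel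

theorem upper : ∃ c ∈ Submodule.span F8 (evalVec '' S), hammingWeight c = 26 := by
  obtain ⟨c, hc, hr⟩ := decode witness (by
    intro v hv
    obtain ⟨s, k, rfl⟩ := genL_idx v (witness_mem v hv)
    refine ⟨_, ?_, gen_Rep s k⟩
    refine Submodule.smul_mem _ _ (Submodule.subset_span ⟨_, (mem_SL _).2 ?_, rfl⟩)
    have : ∀ s : Fin 14, SL.getD s 0 ∈ SL := by decide
    exact this s)
  exact ⟨c, hc, by rw [weight_wt hr, witness_wt]⟩

end TC

/-- The generalised toric code `C_S` over `F₈` has minimum distance exactly 26: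
every nonzero codeword has Hamming weight at least 26, and some codeword has
Hamming weight exactly 26. -/
theorem min_dist :
    (∀ c ∈ Submodule.span F8 (evalVec '' S), c ≠ 0 → 26 ≤ hammingWeight c) ∧
    (∃ c ∈ Submodule.span F8 (evalVec '' S), hammingWeight c = 26) := by
  exact ⟨TC.lower, TC.upper⟩
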